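/- arXiv:1706.00350 — 2 statements merged into one kernel-verified Lean document; each statement's English description precedes it below -/
import Mathlib

section
/- Let N ≥ 2, 1 ≤ M < N, and D ≥ 1 be integers. Every maximizer of P_D on [0,1] lies in the interval I = [1-((N-1)/(N-1+D))^{1/D}, 1). -/
open Finset Set

noncomputable def P (N M D : ℕ) (τ : ℝ) : ℝ :=
  (1 - (1 - τ)^D) * ∑ i ∈ range M, ((N-1).choose i : ℝ) * τ^i * (1-τ)^(N-1-i)

/-- `P` factored through the odds `τ / (1 - τ)`, in which the remaining sum is monotone. -/
lemma P_eq_mul_sum_odds (N M D : ℕ) (hMN : M < N) {τ : ℝ} (hτ : τ < 1) :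
    P N M D τ = (1 - (1 - τ)^D) * (1 - τ)^(N-1) *
      ∑ i ∈ range M, ((N-1).choose i : ℝ) * (τ / (1 - τ))^i := by
  have hq : (1 - τ) ≠ 0 := by linarith
  rw [P, mul_assoc]
  congr 1
  rw [Finset.mul_sum]
  refine Finset.sum_congr rfl fun i hi => ?_
  have hi' : i ≤ N - 1 := by have := Finset.mem_range.1 hi; omega
  have h : (1 - τ)^(N-1) = (1 - τ)^(N-1-i) * (1 - τ)^i := by
    rw [← pow_add, Nat.sub_add_cancel hi']
  rw [h, div_pow]
  field_simp

/-- Strict Bernoulli inequality in weighted AM-GM form. -/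
lemma add_mul_pow_lt (n D : ℕ) (hn : 1 ≤ n) (hD : 1 ≤ D) {r : ℝ} (hr : 1 < r) :
    ((n : ℝ) + D) * r^n < n * r^(n + D) + D := by
  have hn' : (0:ℝ) < n := by exact_mod_cast hn
  have hD' : (0:ℝ) < D := by exact_mod_cast hD
  have hs : 1 < r^n := one_lt_pow₀ hr (by omega)
  have hp : (1:ℝ) < ((n:ℝ) + D) / n := by rw [lt_div_iff₀ hn']; linarith
  have h := one_add_mul_self_lt_rpow_one_add (s := r^n - 1) (by linarith) (by linarith) hp
  have e : (1 + (r^n - 1)) ^ (((n:ℝ) + D) / n) = r^(n + D) := by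
    rw [add_sub_cancel, ← Real.rpow_natCast r n, ← Real.rpow_mul (by linarith),
      mul_div_cancel₀ _ hn'.ne', ← Nat.cast_add, Real.rpow_natCast]
  rw [e] at h
  have h2 := mul_lt_mul_of_pos_left h hn'
  have e2 : (n:ℝ) * (1 + ((n:ℝ) + D) / n * (r^n - 1)) = n + (n + D) * (r^n - 1) := by
    field_simp
  rw [e2] at h2
  linarith

lemma one_sub_pow_mul_pow_lt (n D : ℕ) (hn : 1 ≤ n) (hD : 1 ≤ D) {a q : ℝ} (ha : 0 < a)
    (haD : a^D = (n : ℝ) / (n + D)) (haq : a < q) :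
    (1 - q^D) * q^n < (1 - a^D) * a^n := by
  have hnD : (0:ℝ) < (n:ℝ) + D := by positivity
  obtain ⟨r, rfl⟩ : ∃ r, q = a * r := ⟨q / a, by field_simp⟩
  have hr : 1 < r := by
    by_contra! h
    nlinarith
  have h := add_mul_pow_lt n D hn hD hr
  have han : 0 < a^n := by positivity
  have key : (1 - a^D) * a^n - (1 - (a * r)^D) * (a * r)^n =
      a^n / (n + D) * (n * r^(n + D) + D - (n + D) * r^n) := by
    rw [mul_pow, mul_pow, haD]
    field_simp
    ring
  have : 0 < a^n / ((n:ℝ) + D) * (n * r^(n + D) + D - (n + D) * r^n) :=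
    mul_pos (by positivity) (by linarith)
  linarith

theorem stmt1 (N M D : ℕ) (hN : 2 ≤ N) (hM : 1 ≤ M) (hMN : M < N) (hD : 1 ≤ D) :
    ∀ τs ∈ Icc (0:ℝ) 1, (∀ τ ∈ Icc (0:ℝ) 1, P N M D τ ≤ P N M D τs) →
      τs ∈ Ico (1 - (((N:ℝ)-1)/((N:ℝ)-1+(D:ℝ))) ^ ((1:ℝ)/(D:ℝ))) 1 := by
  intro τs hτs hmax
  have hcast : (N:ℝ) - 1 = ((N - 1 : ℕ) : ℝ) := by
    rw [Nat.cast_sub (by omega), Nat.cast_one]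
  rw [hcast]
  have hn : (0:ℝ) < ((N - 1 : ℕ) : ℝ) := by exact_mod_cast (by omega : 0 < N - 1)
  have hD' : (0:ℝ) < D := by exact_mod_cast hD
  set c : ℝ := ((N - 1 : ℕ) : ℝ) / (((N - 1 : ℕ) : ℝ) + D) with hc
  have hc0 : 0 < c := by positivity
  have hc1 : c < 1 := by rw [hc, div_lt_one (by positivity)]; linarith
  set a : ℝ := c ^ ((1:ℝ) / D) with ha
  have ha0 : 0 < a := Real.rpow_pos_of_pos hc0 _
  have ha1 : a < 1 := Real.rpow_lt_one hc0.le hc1 (by positivity)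
  have haD : a^D = c := by
    rw [ha, one_div, Real.rpow_inv_natCast_pow hc0.le (by omega)]
  have hsum : ∀ t : ℝ, 0 ≤ t → 0 < ∑ i ∈ range M, ((N-1).choose i : ℝ) * t^i := fun t ht =>
    Finset.sum_pos' (fun i _ => by positivity) ⟨0, Finset.mem_range.2 hM, by simp⟩
  have hPa : 0 < P N M D (1 - a) := by
    rw [P_eq_mul_sum_odds N M D hMN (by linarith), sub_sub_cancel, haD]
    have := hsum ((1 - a) / a) (div_nonneg (by linarith) ha0.le)
    have : 0 < 1 - c := by linarith
    positivity
  have hle := hmax (1 - a) ⟨by linarith, by linarith⟩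
  have hlt : τs < 1 := by
    refine lt_of_le_of_ne hτs.2 ?_
    rintro rfl
    have h1 : P N M D 1 = 0 := by
      rw [P, Finset.sum_eq_zero, mul_zero]
      intro i hi
      have := Finset.mem_range.1 hi
      rw [sub_self, zero_pow (by omega), mul_zero]
    linarith
  refine ⟨?_, hlt⟩
  by_contra! hτ
  have hq : a < 1 - τs := by linarith
  rw [P_eq_mul_sum_odds N M D hMN (by linarith), P_eq_mul_sum_odds N M D hMN hlt,
    sub_sub_cancel] at hle
  have hodds : τs / (1 - τs) ≤ (1 - a) / a := by
    rw [div_le_div_iff₀ (by linarith) ha0]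
    nlinarith
  have hodds0 : 0 ≤ τs / (1 - τs) := div_nonneg hτs.1 (by linarith)
  have hmono : ∑ i ∈ range M, ((N-1).choose i : ℝ) * (τs / (1 - τs))^i ≤
      ∑ i ∈ range M, ((N-1).choose i : ℝ) * ((1 - a) / a)^i := by
    gcongr
  have hf := one_sub_pow_mul_pow_lt (N - 1) D (by omega) hD ha0 haD hq
  have hfa : 0 ≤ (1 - a^D) * a^(N-1) := by
    rw [haD]
    exact mul_nonneg (by linarith) (by positivity)
  have h1 := mul_lt_mul_of_pos_right hf (hsum _ hodds0)
  have h2 := mul_le_mul_of_nonneg_left hmono hfa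
  linarith
end

section
/- Let N and M be integers with 2 ≤ M < N. For every τ ∈ (0,1), the derivative of H_1 satisfies H_1'(τ) > 0. -/
open Finset Set

noncomputable def f1 (N M : ℕ) (τ : ℝ) : ℝ :=
  ∑ i ∈ range M, ((N-1).choose i : ℝ) * τ^i * (1-τ)^(N-1-i)

noncomputable def f2 (N M : ℕ) (τ : ℝ) : ℝ :=
  ∑ i ∈ range M, (i : ℝ) * ((N-1).choose i : ℝ) * τ^i * (1-τ)^(N-1-i)

noncomputable def H1 (N M : ℕ) (τ : ℝ) : ℝ := f2 N M τ / f1 N M τ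

lemma hasDerivAt_pow_mul_one_sub_pow (a b : ℕ) {τ : ℝ} (h0 : τ ≠ 0) (h1 : 1 - τ ≠ 0) :
    HasDerivAt (fun x : ℝ => x ^ a * (1 - x) ^ b)
      (τ ^ a * (1 - τ) ^ b * ((a - (a + b) * τ) / (τ * (1 - τ)))) τ := by
  have h := (hasDerivAt_pow a τ).mul (((hasDerivAt_id τ).const_sub 1).pow b)
  refine h.congr_deriv ?_
  have ha : (a : ℝ) * τ ^ (a - 1) = a * τ ^ a / τ := by
    cases a with
    | zero => simp
    | succ a => rw [Nat.add_sub_cancel, pow_succ]; field_simp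
  have hb : (b : ℝ) * (1 - τ) ^ (b - 1) = b * (1 - τ) ^ b / (1 - τ) := by
    cases b with
    | zero => simp
    | succ b => rw [Nat.add_sub_cancel, pow_succ]; field_simp
  simp only [id_eq, Pi.pow_apply]
  rw [ha, hb]
  field_simp
  ring

/-- Logarithmic-derivative formula for weighted truncated binomial sums. -/
lemma hasDerivAt_sum_binomial {N M : ℕ} (hMN : M < N) (c : ℕ → ℝ) {τ : ℝ}
    (hτ : τ ∈ Ioo (0 : ℝ) 1) :
    HasDerivAt (fun x : ℝ => ∑ i ∈ range M, c i * (x ^ i * (1 - x) ^ (N - 1 - i)))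
      ((∑ i ∈ range M, i * (c i * (τ ^ i * (1 - τ) ^ (N - 1 - i))) -
        ((N - 1 : ℕ) : ℝ) * τ * ∑ i ∈ range M, c i * (τ ^ i * (1 - τ) ^ (N - 1 - i))) /
          (τ * (1 - τ))) τ := by
  have h0 : τ ≠ 0 := hτ.1.ne'
  have h1 : 1 - τ ≠ 0 := (sub_pos.2 hτ.2).ne'
  have h := HasDerivAt.fun_sum (u := range M) fun i _ =>
    (hasDerivAt_pow_mul_one_sub_pow i (N - 1 - i) h0 h1).const_mul (c i)
  refine h.congr_deriv ?_
  rw [mul_sum, ← sum_sub_distrib, sum_div]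
  refine sum_congr rfl fun i hi => ?_
  have hi' := Finset.mem_range.1 hi
  have hn : (i : ℝ) + ((N - 1 - i : ℕ) : ℝ) = ((N - 1 : ℕ) : ℝ) := by
    rw [← Nat.cast_add]
    congr 1
    omega
  rw [hn]
  ring

/-- Strict Cauchy–Schwarz for the first two moments of positive weights on `range M`. -/
lemma sq_sum_mul_lt_of_pos {M : ℕ} (hM : 2 ≤ M) {w : ℕ → ℝ} (hw : ∀ i ∈ range M, 0 < w i) :
    (∑ i ∈ range M, i * w i) ^ 2 <
      (∑ i ∈ range M, w i) * ∑ i ∈ range M, i * (i * w i) := by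
  have m0 : 0 ∈ range M := Finset.mem_range.2 (by omega)
  have m1 : 1 ∈ range M := Finset.mem_range.2 (by omega)
  set A := ∑ i ∈ range M, w i
  set B := ∑ i ∈ range M, i * w i
  set C := ∑ i ∈ range M, i * (i * w i)
  have hA : 0 < A := sum_pos hw ⟨0, m0⟩
  have hB : 0 < B := sum_pos' (fun i hi => mul_nonneg i.cast_nonneg (hw i hi).le)
    ⟨1, m1, by simpa using hw 1 m1⟩
  have hpos : 0 < ∑ i ∈ range M, (A * i - B) ^ 2 * w i :=
    sum_pos' (fun i hi => mul_nonneg (sq_nonneg _) (hw i hi).le)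
      ⟨0, m0, by simpa using mul_pos (pow_pos hB 2) (hw 0 m0)⟩
  have hexp (a b : ℝ) :
      ∑ i ∈ range M, (a * i - b) ^ 2 * w i = a ^ 2 * C - 2 * a * b * B + b ^ 2 * A := by
    simp only [A, B, C, mul_sum]
    rw [← sum_sub_distrib, ← sum_add_distrib]
    exact sum_congr rfl fun i _ => by ring
  rw [hexp] at hpos
  have : 0 < A * (A * C - B ^ 2) := by linarith
  linarith [(mul_pos_iff_of_pos_left hA).1 this]

theorem stmt4 (N M : ℕ) (hM : 2 ≤ M) (hMN : M < N) :
    ∀ τ ∈ Ioo (0:ℝ) 1, 0 < deriv (H1 N M) τ := by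
  intro τ hτ
  have h1 : 0 < 1 - τ := sub_pos.2 hτ.2
  have e1 : f1 N M = fun x : ℝ =>
      ∑ i ∈ range M, ((N - 1).choose i : ℝ) * (x ^ i * (1 - x) ^ (N - 1 - i)) := by
    funext x
    exact sum_congr rfl fun i _ => by ring
  have e2 : f2 N M = fun x : ℝ =>
      ∑ i ∈ range M, ((i : ℝ) * ((N - 1).choose i : ℝ)) * (x ^ i * (1 - x) ^ (N - 1 - i)) := by
    funext x
    exact sum_congr rfl fun i _ => by ring
  have d1 := hasDerivAt_sum_binomial hMN (fun i => ((N - 1).choose i : ℝ)) hτ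
  have d2 := hasDerivAt_sum_binomial hMN (fun i => (i : ℝ) * ((N - 1).choose i : ℝ)) hτ
  have hw : ∀ i ∈ range M, 0 < ((N - 1).choose i : ℝ) * (τ ^ i * (1 - τ) ^ (N - 1 - i)) := by
    intro i hi
    have hi' := Finset.mem_range.1 hi
    have hc : 0 < (N - 1).choose i := Nat.choose_pos (by omega)
    have h0 := hτ.1
    positivity
  have hA := sum_pos hw ⟨0, Finset.mem_range.2 (by omega)⟩
  have key := sq_sum_mul_lt_of_pos hM hw
  have hd := d2.fun_div d1 hA.ne'
  have eH : H1 N M = fun x => f2 N M x / f1 N M x := rfl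
  rw [eH, e1, e2, hd.deriv]
  simp only [mul_assoc] at key hA ⊢
  refine div_pos ?_ (pow_pos hA 2)
  rw [div_mul_eq_mul_div, mul_div_assoc', ← sub_div]
  refine div_pos ?_ (mul_pos hτ.1 h1)
  linarith
end
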